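/- Let E be an infinite-dimensional real Banach space and let I : E → ℝ be continuously Fréchet differentiable, even (I(-u) = I(u) for all u), bounded from below, with I(0) = 0. Assume: (local Palais–Smale condition) there exists c* > 0 such that every sequence {u_k} ⊂ E with I(u_k) → c for some c < c* and I'(u_k) → 0 in E* has a convergent subsequence; and for each k ∈ ℕ there exists a closed set A_k ⊂ E∖{0}, symmetric with respect to the origin, with genus γ(A_k) ≥ k and sup_{u ∈ A_k} I(u) < 0. Then there exists a sequence {u_k} ⊂ E of critical points of I (i.e. I'(u_k) = 0) with u_k ≠ 0, I(u_k) ≤ 0 for all k, and u_k → 0 in E as k → ∞. -/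

import Mathlib

open Filter

/-- The Krasnoselskii genus of a subset `A` of a real normed space `E`: the smallest
`n : ℕ` for which there exists a map `f : E → ℝⁿ` that is continuous on `A`, odd
on `A`, and nonvanishing on `A`; it is `⊤` if no such `n` exists (so `genus ∅ = 0`). -/
noncomputable def genus {E : Type*} [NormedAddCommGroup E] [NormedSpace ℝ E]
    (A : Set E) : ℕ∞ :=
  sInf {k : ℕ∞ | ∃ n : ℕ, k = (n : ℕ∞) ∧
    ∃ f : E → (Fin n → ℝ), ContinuousOn f A ∧ (∀ u ∈ A, f (-u) = -f u) ∧
      ∀ u ∈ A, f u ≠ 0}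

/-- `A` admits an odd continuous map into `ℝⁿ ∖ {0}`. -/
def HasOddMap {E : Type*} [NormedAddCommGroup E] [NormedSpace ℝ E] (A : Set E) (n : ℕ) : Prop :=
  ∃ f : E → (Fin n → ℝ), ContinuousOn f A ∧ (∀ u ∈ A, f (-u) = -f u) ∧ ∀ u ∈ A, f u ≠ 0

section Auxiliary

open Set Topology

theorem exists_continuousOn_mem_convex {E F : Type*} [NormedAddCommGroup E]
    [NormedAddCommGroup F] [NormedSpace ℝ F] {X : Set E} (t : E → Set F)
    (ht : ∀ x ∈ X, Convex ℝ (t x)) (H : ∀ x ∈ X, ∃ c, ∀ᶠ y in 𝓝[X] x, c ∈ t y) :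
    ∃ g : E → F, ContinuousOn g X ∧ ∀ x ∈ X, g x ∈ t x := by
  classical
  obtain ⟨g, hg⟩ := exists_continuous_forall_mem_convex_of_local_const
    (X := X) (t := fun x => t x) (fun x => ht x x.2) (fun x => by
      obtain ⟨c, hc⟩ := H x x.2
      exact ⟨c, (eventually_nhds_subtype_iff X x (fun y => c ∈ t y)).2 hc⟩)
  refine ⟨fun u => if h : u ∈ X then g ⟨u, h⟩ else 0, ?_, fun x hx => by simpa [hx] using hg ⟨x, hx⟩⟩
  rw [continuousOn_iff_continuous_domRestrict]
  convert g.continuous using 1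
  ext x
  simp

theorem infDist_neg_of_symm {E : Type*} [NormedAddCommGroup E] {K : Set E} (hK : ∀ u ∈ K, -u ∈ K) (u : E) :
    Metric.infDist (-u) K = Metric.infDist u K := by
  have hKe : (fun x : E => -x) '' K = K := by
    ext x
    exact ⟨fun ⟨y, hy, h⟩ => h ▸ hK y hy, fun hx => ⟨-x, hK x hx, neg_neg x⟩⟩
  have h := Metric.infDist_image (t := K) (x := u) (isometry_neg (G := E))
  rw [hKe] at h
  exact h

variable {E : Type*} [NormedAddCommGroup E] [NormedSpace ℝ E]

theorem HasOddMap.genus_le {A : Set E} {n : ℕ} (h : HasOddMap A n) : genus A ≤ n :=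
  sInf_le ⟨n, rfl, h⟩

theorem HasOddMap.mono {A B : Set E} {n : ℕ} (h : HasOddMap B n) (hAB : A ⊆ B) :
    HasOddMap A n := by
  obtain ⟨f, hc, ho, hz⟩ := h
  exact ⟨f, hc.mono hAB, fun u hu => ho u (hAB hu), fun u hu => hz u (hAB hu)⟩

/-- If `A` maps oddly and continuously into a set `B`, an odd map on `B` pulls back to `A`. -/
theorem HasOddMap.comp {A B : Set E} {n : ℕ} (h : HasOddMap B n) {g : E → E}
    (hg : ContinuousOn g A) (hodd : ∀ u ∈ A, g (-u) = -g u) (hmaps : MapsTo g A B) :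
    HasOddMap A n := by
  obtain ⟨f, hc, ho, hz⟩ := h
  exact ⟨f ∘ g, hc.comp hg hmaps, fun u hu => by simp [hodd u hu, ho _ (hmaps hu)],
    fun u hu => hz _ (hmaps hu)⟩

/-- Subadditivity: an odd map on a closed set can be completed by a globally defined one. -/
theorem HasOddMap.add {A S : Set E} {n m : ℕ} (h : HasOddMap A n) (hA : IsClosed A)
    (hsymm : ∀ u ∈ A, -u ∈ A) {p : E → (Fin m → ℝ)} (hp : Continuous p)
    (hpodd : ∀ u, p (-u) = -p u) (hS : ∀ u ∈ S, u ∈ A ∨ p u ≠ 0) :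
    HasOddMap S (n + m) := by
  obtain ⟨f, hc, ho, hz⟩ := h
  obtain ⟨g, hg⟩ := ContinuousMap.exists_restrict_eq hA
    ⟨_, continuousOn_iff_continuous_domRestrict.1 hc⟩
  have hgf : ∀ u ∈ A, g u = f u := fun u hu => congrArg (fun k => k ⟨u, hu⟩) hg
  refine ⟨fun u => Fin.append (fun i => g u i - g (-u) i) (p u), ?_, ?_, ?_⟩
  · refine Continuous.continuousOn (continuous_pi fun i => ?_)
    refine Fin.addCases (fun i => ?_) (fun i => ?_) i
    · simp only [Fin.append_left]; fun_prop
    · simp only [Fin.append_right]; fun_prop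
  · intro u _
    ext i
    refine Fin.addCases (fun i => ?_) (fun i => ?_) i
    · simp
    · simp [hpodd]
  · intro u hu h0
    rcases hS u hu with hu | hu
    · apply hz u hu
      ext i
      have := congrFun h0 (Fin.castAdd m i)
      simp [hgf u hu, hgf _ (hsymm u hu), ho u hu] at this
      simpa using this
    · apply hu
      ext i
      simpa using congrFun h0 (Fin.natAdd n i)

/-- A compact set missing the origin has a neighbourhood on which a linear map into some `ℝᵐ`
does not vanish. -/
theorem exists_clm_ne_zero_near_compact {K : Set E} (hK : IsCompact K) (hne : K.Nonempty)
    (h0 : (0 : E) ∉ K) :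
    ∃ (r : ℝ) (m : ℕ) (p : E →L[ℝ] (Fin m → ℝ)), 0 < r ∧
      ∀ u, Metric.infDist u K ≤ 2 * r → p u ≠ 0 := by
  have hex : ∀ x : K, ∃ l : StrongDual ℝ E, l x ≠ 0 := fun x =>
    SeparatingDual.exists_ne_zero (fun h => h0 (h ▸ x.2))
  choose l hl using hex
  obtain ⟨t, ht⟩ := hK.elim_finite_subcover (fun x : K => {u | l x u ≠ 0})
    (fun x => isOpen_ne_fun (l x).continuous continuous_const)
    (fun x hx => mem_iUnion.2 ⟨⟨x, hx⟩, hl _⟩)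
  let p : E →L[ℝ] (Fin t.card → ℝ) :=
    ContinuousLinearMap.pi fun i => l (t.equivFin.symm i)
  have hpK : K ⊆ {u | p u ≠ 0} := by
    intro u hu hpu
    obtain ⟨x, hx, hxu⟩ := mem_iUnion₂.1 (ht hu)
    apply hxu
    simpa [p] using congrFun hpu (t.equivFin ⟨x, hx⟩)
  obtain ⟨δ, hδ, hsub⟩ := hK.exists_cthickening_subset_open
    (isOpen_ne_fun p.continuous continuous_const) hpK
  refine ⟨δ / 2, t.card, p, by positivity, fun u hu => hsub ?_⟩
  obtain ⟨y, hy, hyu⟩ := hK.exists_infDist_eq_dist hne u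
  exact Metric.mem_cthickening_of_dist_le u y δ K hy (by linarith)

theorem fderiv_neg_of_even {I : E → ℝ} (hI : Differentiable ℝ I) (heven : ∀ u, I (-u) = I u)
    (u : E) : fderiv ℝ I (-u) = -fderiv ℝ I u := by
  have h := (hI (-u)).hasFDerivAt.comp u (hasFDerivAt_id u).neg
  have h2 : I ∘ Neg.neg = I := funext fun x => heven x
  rw [h2] at h
  rw [h.fderiv]
  ext x
  simp

theorem exists_unit_slope_field {I : E → ℝ} (hI : ContDiff ℝ 1 I)
    (heven : ∀ u, I (-u) = I u) :
    ∃ V : E → E, ContinuousOn V {u | fderiv ℝ I u ≠ 0} ∧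
      ∀ u, fderiv ℝ I u ≠ 0 → V (-u) = -V u ∧ ‖V u‖ ≤ 1 ∧
        ‖fderiv ℝ I u‖ / 2 < fderiv ℝ I u (V u) := by
  have hd : Differentiable ℝ I := hI.differentiable (by norm_num)
  have hcont : Continuous (fderiv ℝ I) := hI.continuous_fderiv (by norm_num)
  have hneg := fderiv_neg_of_even hd heven
  obtain ⟨V, hVc, hV⟩ := exists_continuousOn_mem_convex (X := {u | fderiv ℝ I u ≠ 0})
    (fun u => {v : E | ‖v‖ ≤ 1 ∧ ‖fderiv ℝ I u‖ / 2 < fderiv ℝ I u v}) (by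
      intro u _
      refine Convex.inter (s := {v : E | ‖v‖ ≤ 1}) (t := {v : E | ‖fderiv ℝ I u‖ / 2 < fderiv ℝ I u v}) ?_
        (convex_halfSpace_gt (fderiv ℝ I u).toLinearMap.isLinear _)
      simpa [Metric.closedBall, dist_eq_norm] using convex_closedBall (0 : E) 1) (by
      intro u hu
      have hpos : 0 < ‖fderiv ℝ I u‖ := norm_pos_iff.2 hu
      obtain ⟨v, hv1, hv2⟩ :=
        (fderiv ℝ I u).exists_lt_apply_of_lt_opNorm (half_lt_self hpos)
      obtain ⟨v, hv1, hv2⟩ : ∃ v : E, ‖v‖ ≤ 1 ∧ ‖fderiv ℝ I u‖ / 2 < fderiv ℝ I u v := by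
        rcases lt_max_iff.1 hv2 with h | h
        · exact ⟨v, hv1.le, h⟩
        · exact ⟨-v, by simpa using hv1.le, by simpa using h⟩
      refine ⟨v, nhdsWithin_le_nhds ?_⟩
      have hlt : ∀ᶠ y in 𝓝 u, ‖fderiv ℝ I y‖ / 2 < fderiv ℝ I y v :=
        ContinuousAt.eventually_lt (by fun_prop)
          ((hcont.clm_apply continuous_const).continuousAt) hv2
      filter_upwards [hlt] with y hy using ⟨hv1, hy⟩)
  have hnz : ∀ u, fderiv ℝ I u ≠ 0 → fderiv ℝ I (-u) ≠ 0 := fun u hu => by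
    rw [hneg]; exact neg_ne_zero.2 hu
  refine ⟨fun u => (1 / 2 : ℝ) • (V u - V (-u)), ?_, fun u hu => ⟨?_, ?_, ?_⟩⟩
  · exact (hVc.sub (hVc.comp continuousOn_neg fun u hu => hnz u hu)).const_smul _
  · simp only [neg_neg, ← smul_neg, neg_sub]
  · have h1 := (hV u hu).1
    have h2 := (hV _ (hnz u hu)).1
    have h3 := norm_sub_le (V u) (V (-u))
    rw [norm_smul]
    norm_num
    linarith
  · have h1 := (hV u hu).2
    have h2 := (hV _ (hnz u hu)).2
    simp only [hneg, norm_neg, neg_apply] at h2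
    simp only [map_smul, map_sub, smul_eq_mul]
    linarith

/-- An odd continuous field of short steps decreasing `I`, defined away from critical points. -/
theorem exists_descent_field {I : E → ℝ} (hI : ContDiff ℝ 1 I)
    (heven : ∀ u, I (-u) = I u) {r : ℝ} (hr : 0 < r) :
    ∃ w : E → E, ContinuousOn w {u | fderiv ℝ I u ≠ 0} ∧
      ∀ u, fderiv ℝ I u ≠ 0 → w (-u) = -w u ∧ w u ≠ 0 ∧ ‖w u‖ ≤ r ∧
        ∀ t ∈ Icc (0 : ℝ) 1, I (u - t • w u) ≤ I u - t * ‖w u‖ * (‖fderiv ℝ I u‖ / 2) := by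
  have hd : Differentiable ℝ I := hI.differentiable (by norm_num)
  have hcont : Continuous (fderiv ℝ I) := hI.continuous_fderiv (by norm_num)
  have hneg := fderiv_neg_of_even hd heven
  have hnz : ∀ u, fderiv ℝ I u ≠ 0 → fderiv ℝ I (-u) ≠ 0 := fun u hu => by
    rw [hneg]; exact neg_ne_zero.2 hu
  obtain ⟨V, hVc, hV⟩ := exists_unit_slope_field hI heven
  obtain ⟨h, hhc, hh⟩ := exists_continuousOn_mem_convex (X := {u | fderiv ℝ I u ≠ 0})
    (fun u => {h : ℝ | 0 < h ∧ h ≤ r ∧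
      ∀ t ∈ Icc (0 : ℝ) h, I (u - t • V u) ≤ I u - t * (‖fderiv ℝ I u‖ / 2)}) (by
      intro u _
      rw [convex_iff_ordConnected]
      refine ⟨fun a ha b hb c hc => ⟨ha.1.trans_le hc.1, hc.2.trans hb.2.1, fun t ht => ?_⟩⟩
      exact hb.2.2 t ⟨ht.1, ht.2.trans hc.2⟩) (by
      intro u hu
      have hopen : IsOpen {u | fderiv ℝ I u ≠ 0} := isOpen_ne_fun hcont continuous_const
      have hVu : ContinuousAt V u := hVc.continuousAt (hopen.mem_nhds hu)
      have hev : ∀ᶠ z : E × E in 𝓝 (u, u),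
          ‖fderiv ℝ I z.2‖ / 2 < fderiv ℝ I z.1 (V z.2) := by
        have hV2 : ContinuousAt (fun z : E × E => V z.2) (u, u) :=
          ContinuousAt.comp (f := Prod.snd) (x := (u, u)) hVu continuousAt_snd
        refine ContinuousAt.eventually_lt (by fun_prop) ?_ (hV u hu).2.2
        exact (hcont.continuousAt.comp continuousAt_fst).clm_apply hV2
      obtain ⟨ε, hε, hball⟩ := Metric.eventually_nhds_iff_ball.1 hev
      refine ⟨min (ε / 2) r, ?_⟩
      rw [hopen.nhdsWithin_eq hu]
      filter_upwards [Metric.ball_mem_nhds u (half_pos hε), hopen.mem_nhds hu] with y hy hyG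
      refine ⟨by positivity, min_le_right _ _, fun t ht => ?_⟩
      have hder : ∀ s : ℝ, HasDerivAt (fun s : ℝ => I (y - s • V y) + s * (‖fderiv ℝ I y‖ / 2))
          (-(fderiv ℝ I (y - s • V y) (V y)) + ‖fderiv ℝ I y‖ / 2) s := by
        intro s
        have h1 : HasDerivAt (fun s : ℝ => y - s • V y) (-V y) s := by
          simpa using ((hasDerivAt_id s).smul_const (V y)).const_sub y
        have h2 := (hd (y - s • V y)).hasFDerivAt.comp_hasDerivAt s h1
        have h3 := h2.add ((hasDerivAt_id s).mul_const (‖fderiv ℝ I y‖ / 2))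
        simpa using! h3
      have hanti : AntitoneOn (fun s : ℝ => I (y - s • V y) + s * (‖fderiv ℝ I y‖ / 2))
          (Icc 0 (min (ε / 2) r)) := by
        refine antitoneOn_of_deriv_nonpos (convex_Icc _ _)
          (fun s _ => (hder s).continuousAt.continuousWithinAt)
          (fun s _ => (hder s).differentiableAt.differentiableWithinAt) fun s hs => ?_
        rw [(hder s).deriv]
        rw [interior_Icc] at hs
        have hs2 : s < ε / 2 := hs.2.trans_le (min_le_left _ _)
        have hmem : ((y - s • V y, y) : E × E) ∈ Metric.ball (u, u) ε := by
          rw [← ball_prod_same]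
          refine ⟨?_, Metric.ball_subset_ball (by linarith) hy⟩
          rw [Metric.mem_ball] at hy ⊢
          have hle : dist (y - s • V y) y ≤ s := by
            rw [dist_eq_norm, sub_sub_cancel_left, norm_neg, norm_smul, Real.norm_of_nonneg hs.1.le]
            nlinarith [(hV y hyG).2.1, hs.1]
          exact (dist_triangle _ y _).trans_lt (by linarith)
        have := hball _ hmem
        dsimp only at this
        linarith
      have := hanti (left_mem_Icc.2 (by positivity)) ht ht.1
      simp only [zero_smul, sub_zero, zero_mul, add_zero] at this
      linarith)
  have hVne : ∀ u, fderiv ℝ I u ≠ 0 → V u ≠ 0 := by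
    intro u hu h0
    have := (hV u hu).2.2
    rw [h0, map_zero] at this
    linarith [norm_nonneg (fderiv ℝ I u)]
  refine ⟨fun u => min (h u) (h (-u)) • V u, ?_, fun u hu => ?_⟩
  · exact (hhc.inf (hhc.comp continuousOn_neg fun u hu => hnz u hu)).smul hVc
  have hm : 0 < min (h u) (h (-u)) := lt_min (hh u hu).1 (hh _ (hnz u hu)).1
  have hn : ‖min (h u) (h (-u)) • V u‖ ≤ min (h u) (h (-u)) := by
    rw [norm_smul, Real.norm_of_nonneg hm.le]
    nlinarith [(hV u hu).2.1]
  refine ⟨by simp [(hV u hu).1, min_comm], smul_ne_zero hm.ne' (hVne u hu),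
    hn.trans ((min_le_left _ _).trans (hh u hu).2.1), fun t ht => ?_⟩
  have key := (hh u hu).2.2 (t * min (h u) (h (-u)))
    ⟨mul_nonneg ht.1 hm.le, (mul_le_of_le_one_left hm.le ht.2).trans (min_le_left _ _)⟩
  rw [smul_smul]
  have : t * ‖min (h u) (h (-u)) • V u‖ * (‖fderiv ℝ I u‖ / 2) ≤
      t * min (h u) (h (-u)) * (‖fderiv ℝ I u‖ / 2) := by
    have := ht.1
    gcongr
  linarith

/-- Iterating the steps `u ↦ u - w u`, every point of `X` eventually drops below the level `a`;
the iterates can be interpolated into one continuous odd map. -/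
theorem exists_odd_deformation [CompleteSpace E] {I : E → ℝ} (hI : Continuous I)
    {B : ℝ} (hB : ∀ u, B ≤ I u) {X : Set E} (hX : IsClosed X)
    (hsymm : ∀ u ∈ X, -u ∈ X) {w : E → E} (hw : ContinuousOn w X)
    (hodd : ∀ u ∈ X, w (-u) = -w u)
    (hstep : ∀ u ∈ X, ∀ t ∈ Icc (0 : ℝ) 1, u - t • w u ∈ X) {β : ℝ} (hβ : 0 < β)
    (hdec : ∀ u ∈ X, ∀ t ∈ Icc (0 : ℝ) 1, I (u - t • w u) ≤ I u - t * ‖w u‖ * β) {a : ℝ}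
    (hne : ∀ u ∈ X, a ≤ I u → w u ≠ 0) :
    ∃ g : E → E, ContinuousOn g X ∧ (∀ u ∈ X, g (-u) = -g u) ∧
      MapsTo g X {u | I u < a} := by
  set f : E → E := fun u => u - w u with hf
  have hfX : MapsTo f X X := fun u hu => by simpa [hf] using hstep u hu 1 (by simp)
  have hfc : ContinuousOn f X := continuousOn_id.sub hw
  have hfdec : ∀ u ∈ X, I (f u) ≤ I u - ‖w u‖ * β := fun u hu => by
    simpa [hf] using hdec u hu 1 (by simp)
  have hitX : ∀ n, MapsTo (f^[n]) X X := fun n => hfX.iterate n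
  have hitc : ∀ n, ContinuousOn (f^[n]) X := fun n => hfc.iterate hfX n
  have hitodd : ∀ n, ∀ u ∈ X, f^[n] (-u) = -f^[n] u := by
    intro n
    induction n with
    | zero => simp
    | succ n ih =>
      intro u hu
      rw [Function.iterate_succ_apply', Function.iterate_succ_apply', ih u hu]
      simp only [hf]
      rw [hodd _ (hitX n hu)]
      abel
  have hreach : ∀ u ∈ X, ∃ n, I (f^[n] u) < a := by
    intro u hu
    by_contra! hcon
    have hsum : Summable fun n => ‖w (f^[n] u)‖ := by
      refine summable_of_sum_range_le (c := (I u - B) / β) (fun n => norm_nonneg _) fun n => ?_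
      rw [le_div_iff₀ hβ]
      have : ∀ n, (∑ i ∈ Finset.range n, ‖w (f^[i] u)‖) * β ≤ I u - I (f^[n] u) := by
        intro n
        induction n with
        | zero => simp
        | succ n ih =>
          rw [Finset.sum_range_succ, Function.iterate_succ_apply']
          have := hfdec _ (hitX n hu)
          linarith
      linarith [this n, hB (f^[n] u)]
    have hcau : CauchySeq fun n => f^[n] u := by
      refine cauchySeq_of_dist_le_of_summable _ (fun n => ?_) hsum
      rw [Nat.succ_eq_add_one, Function.iterate_succ_apply', dist_eq_norm]
      simp [hf]
    obtain ⟨v, hv⟩ := cauchySeq_tendsto_of_complete hcau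
    have hvX : v ∈ X := hX.mem_of_tendsto hv (Eventually.of_forall fun n => hitX n hu)
    have hva : a ≤ I v := ge_of_tendsto' ((hI.tendsto v).comp hv) hcon
    have hwv : Tendsto (fun n => ‖w (f^[n] u)‖) atTop (𝓝 ‖w v‖) :=
      ((hw v hvX).tendsto.comp (tendsto_nhdsWithin_iff.2
        ⟨hv, Eventually.of_forall fun n => hitX n hu⟩)).norm
    have := tendsto_nhds_unique hwv hsum.tendsto_atTop_zero
    exact hne v hvX hva (norm_eq_zero.1 this)
  obtain ⟨τ, hτc, hτ⟩ := exists_continuousOn_mem_convex (X := X)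
    (fun u => {s : ℝ | ∃ n : ℕ, (n : ℝ) ≤ s ∧ I (f^[n] u) < a}) (by
      intro u _
      rw [convex_iff_ordConnected]
      exact ⟨fun x hx y _ z hz => hx.imp fun n hn => ⟨hn.1.trans hz.1, hn.2⟩⟩) (by
      intro u hu
      obtain ⟨n, hn⟩ := hreach u hu
      refine ⟨n, ?_⟩
      have : ContinuousWithinAt (fun y => I (f^[n] y)) X u :=
        (hI.comp_continuousOn (hitc n)) u hu
      filter_upwards [this.eventually_lt continuousWithinAt_const hn] with y hy
      exact ⟨n, le_rfl, hy⟩)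
  set σ : E → ℝ := fun u => max (τ u) (τ (-u)) with hσ
  have hσc : ContinuousOn σ X := hτc.sup (hτc.comp continuousOn_neg fun u hu => hsymm u hu)
  have hσneg : ∀ u, σ (-u) = σ u := fun u => by simp [hσ, max_comm]
  have hσt : ∀ u ∈ X, ∃ n : ℕ, (n : ℝ) ≤ σ u ∧ I (f^[n] u) < a := fun u hu =>
    (hτ u hu).imp fun n hn => ⟨hn.1.trans (le_max_left _ _), hn.2⟩
  let θ : ℕ → E → ℝ := fun n u => max 0 (min 1 (σ u - n))
  have hθI : ∀ n u, θ n u ∈ Icc (0 : ℝ) 1 := fun n u =>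
    ⟨le_max_left _ _, max_le zero_le_one (min_le_left _ _)⟩
  let G : ℕ → E → E := fun n => Nat.rec (fun u => u) (fun n g u => g u - θ n u • w (g u)) n
  have hGs : ∀ n u, G (n + 1) u = G n u - θ n u • w (G n u) := fun n u => rfl
  have hGX : ∀ n, MapsTo (G n) X X := by
    intro n
    induction n with
    | zero => exact fun u hu => hu
    | succ n ih => exact fun u hu => hstep _ (ih hu) _ (hθI n u)
  have hGc : ∀ n, ContinuousOn (G n) X := by
    intro n
    induction n with
    | zero => exact continuousOn_id
    | succ n ih =>
      have hθc : ContinuousOn (θ n) X :=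
        continuousOn_const.sup (continuousOn_const.inf (hσc.sub continuousOn_const))
      exact ih.sub (hθc.smul (hw.comp ih (hGX n)))
  have hGodd : ∀ n, ∀ u ∈ X, G n (-u) = -G n u := by
    intro n
    induction n with
    | zero => exact fun u _ => rfl
    | succ n ih =>
      intro u hu
      rw [hGs, hGs, ih u hu, hodd _ (hGX n hu)]
      simp only [θ, hσneg, smul_neg]
      abel
  have hGf : ∀ u, ∀ n : ℕ, (n : ℝ) ≤ σ u → G n u = f^[n] u := by
    intro u n
    induction n with
    | zero => exact fun _ => rfl
    | succ n ih =>
      intro hn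
      push_cast at hn
      have h1 : θ n u = 1 := by
        simp only [θ]
        rw [min_eq_left (by linarith), max_eq_right zero_le_one]
      rw [hGs, h1, ih (by linarith), Function.iterate_succ_apply', one_smul]
  have hGdec : ∀ u ∈ X, Antitone fun n => I (G n u) := by
    intro u hu
    refine antitone_nat_of_succ_le fun n => ?_
    have := hdec _ (hGX n hu) _ (hθI n u)
    have h0 : 0 ≤ θ n u * ‖w (G n u)‖ * β :=
      mul_nonneg (mul_nonneg (hθI n u).1 (norm_nonneg _)) hβ.le
    rw [hGs]
    linarith
  have hGconst : ∀ u, ∀ n : ℕ, σ u ≤ n → ∀ k, n ≤ k → G k u = G n u := by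
    intro u n hn k hk
    induction k, hk using Nat.le_induction with
    | base => rfl
    | succ k hk ih =>
      have hnk : (n : ℝ) ≤ k := by exact_mod_cast hk
      have h0 : θ k u = 0 := by
        simp only [θ]
        exact max_eq_left ((min_le_right _ _).trans (by linarith))
      rw [hGs, h0, zero_smul, sub_zero, ih]
  have hceil : ∀ u, ∀ n : ℕ, σ u ≤ n → G ⌈σ u⌉₊ u = G n u := fun u n hn =>
    (hGconst u _ (Nat.le_ceil _) n (Nat.ceil_le.2 hn)).symm
  refine ⟨fun u => G ⌈σ u⌉₊ u, fun u hu => ?_, fun u hu => ?_, fun u hu => ?_⟩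
  · obtain ⟨n, hn⟩ := exists_nat_gt (σ u)
    have hev : ∀ᶠ y in 𝓝[X] u, σ y < n := (hσc u hu).eventually_lt continuousWithinAt_const hn
    refine (hGc n u hu).congr_of_eventuallyEq ?_ (hceil u n hn.le)
    filter_upwards [hev] with y hy using hceil y n hy.le
  · simp only [hσneg, hGodd _ u hu]
  · obtain ⟨n, hn, hna⟩ := hσt u hu
    have hle : n ≤ ⌈σ u⌉₊ := by exact_mod_cast hn.trans (Nat.le_ceil _)
    have := hGdec u hu hle
    simp only [hGf u n hn] at this
    exact this.trans_lt hna

/-- If the slope of `I` is bounded below off a neighbourhood of `K` in `{I ≤ s}`, and by `b` on an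
annulus around `K`, then lowering the level by `b * r / 8` costs only an odd map that does not
vanish near `K`. -/
theorem HasOddMap.sublevel_step [CompleteSpace E] {I : E → ℝ} (hI : ContDiff ℝ 1 I)
    (heven : ∀ u, I (-u) = I u) {B : ℝ} (hB : ∀ u, B ≤ I u) {K : Set E}
    (hKsymm : ∀ u ∈ K, -u ∈ K) {r b β s : ℝ} (hr : 0 < r) (hb : 0 < b) (hβ : 0 < β) (hs : s ≤ 0)
    (hann : ∀ u, r / 2 ≤ Metric.infDist u K → Metric.infDist u K ≤ 2 * r → I u ≤ 0 →
      b ≤ ‖fderiv ℝ I u‖)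
    (hfar : ∀ u, r / 2 ≤ Metric.infDist u K → I u ≤ s → β ≤ ‖fderiv ℝ I u‖)
    {m : ℕ} {p : E →L[ℝ] (Fin m → ℝ)} (hp : ∀ u, Metric.infDist u K ≤ 2 * r → p u ≠ 0) {n : ℕ}
    (h : HasOddMap {u | I u ≤ s - b * r / 8} n) : HasOddMap {u | I u ≤ s} (n + m) := by
  have hbr : 0 < b * r := mul_pos hb hr
  have hIc : Continuous I := hI.continuous
  have hdist := infDist_neg_of_symm hKsymm
  set D : E → ℝ := fun u => Metric.infDist u K with hD
  have hDc : Continuous D := Metric.continuous_infDist_pt K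
  have hDneg : ∀ u, D (-u) = D u := hdist
  have hDlip : ∀ u v, D u ≤ D v + ‖u - v‖ := fun u v => by
    rw [← dist_eq_norm]; exact Metric.infDist_le_infDist_add_dist
  set X : Set E := {u | I u ≤ s ∧ I u - b / 2 * min (D u) r ≤ s - b * r / 2} with hXdef
  have hX : IsClosed X := by
    have hc : Continuous fun u => I u - b / 2 * min (D u) r := by fun_prop
    exact (isClosed_le hIc continuous_const).inter (isClosed_le hc continuous_const)
  have hXsymm : ∀ u ∈ X, -u ∈ X := fun u hu => by
    simpa only [hXdef, mem_ofPred_eq, heven, hDneg] using hu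
  obtain ⟨w, hwc, hw⟩ := exists_descent_field hI heven hr
  set θ : E → ℝ := fun u => max 0 (min 1 (I u - (s - b * r / 4))) with hθ
  have hθc : Continuous θ := by fun_prop
  have hθ0 : ∀ u, 0 ≤ θ u := fun u => le_max_left _ _
  have hθ1 : ∀ u, θ u ≤ 1 := fun u => max_le zero_le_one (min_le_left _ _)
  have hθz : ∀ u, I u ≤ s - b * r / 4 → θ u = 0 := fun u hu =>
    max_eq_left ((min_le_right _ _).trans (by linarith))
  have hDX : ∀ u ∈ X, s - b * r / 4 < I u → r / 2 ≤ D u := by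
    intro u hu hlt
    have h2 := hu.2
    have : r / 2 < min (D u) r := by
      by_contra! hcon
      nlinarith
    exact this.le.trans (min_le_left _ _)
  have hslope : ∀ u ∈ X, s - b * r / 4 < I u → β ≤ ‖fderiv ℝ I u‖ := fun u hu hlt =>
    hfar u (hDX u hu hlt) hu.1
  have hreg : ∀ u ∈ X, s - b * r / 4 < I u → fderiv ℝ I u ≠ 0 := fun u hu hlt =>
    norm_pos_iff.1 (hβ.trans_le (hslope u hu hlt))
  have hdrop : ∀ u ∈ X, s - b * r / 4 < I u → ∀ t ∈ Icc (0 : ℝ) 1,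
      I (u - t • θ u • w u) ≤ I u - t * ‖θ u • w u‖ * (‖fderiv ℝ I u‖ / 2) := by
    intro u hu hlt t ht
    have := (hw u (hreg u hu hlt)).2.2.2 (t * θ u)
      ⟨mul_nonneg ht.1 (hθ0 u), mul_le_one₀ ht.2 (hθ0 u) (hθ1 u)⟩
    rw [smul_smul, norm_smul, Real.norm_of_nonneg (hθ0 u)]
    linarith
  have hdrop' : ∀ u ∈ X, ∀ t ∈ Icc (0 : ℝ) 1,
      I (u - t • θ u • w u) ≤ I u - t * ‖θ u • w u‖ * (β / 2) := by
    intro u hu t ht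
    rcases le_or_gt (I u) (s - b * r / 4) with hle | hlt
    · simp [hθz u hle]
    · refine (hdrop u hu hlt t ht).trans ?_
      have := hslope u hu hlt
      have := ht.1
      gcongr
  have hstepc : ContinuousOn (fun u => θ u • w u) X := by
    intro u hu
    rcases le_or_gt (I u) (s - b * r / 4) with hle | hlt
    · have hbound : ∀ y ∈ X, ‖θ y • w y‖ ≤ θ y * r := by
        intro y hy
        rw [norm_smul, Real.norm_of_nonneg (hθ0 y)]
        rcases le_or_gt (I y) (s - b * r / 4) with hle | hlt
        · simp [hθz y hle]
        · exact mul_le_mul_of_nonneg_left (hw y (hreg y hy hlt)).2.2.1 (hθ0 y)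
      have hlim : Tendsto (fun y => θ y * r) (𝓝[X] u) (𝓝 0) := by
        have : Tendsto (fun y => θ y * r) (𝓝[X] u) (𝓝 (θ u * r)) :=
          ((hθc.mul continuous_const).tendsto u).mono_left nhdsWithin_le_nhds
        rwa [hθz u hle, zero_mul] at this
      have hz : θ u • w u = 0 := by rw [hθz u hle, zero_smul]
      rw [ContinuousWithinAt, hz]
      exact squeeze_zero_norm' (eventually_mem_nhdsWithin.mono hbound) hlim
    · have hopen : IsOpen {u | fderiv ℝ I u ≠ 0} :=
        isOpen_ne_fun (hI.continuous_fderiv (by norm_num)) continuous_const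
      exact (hθc.continuousAt.smul
        (hwc.continuousAt (hopen.mem_nhds (hreg u hu hlt)))).continuousWithinAt
  have hstepodd : ∀ u ∈ X, θ (-u) • w (-u) = -(θ u • w u) := by
    intro u hu
    have hθneg : θ (-u) = θ u := by simp only [hθ, heven]
    rcases le_or_gt (I u) (s - b * r / 4) with hle | hlt
    · simp [hθneg, hθz u hle]
    · simp [hθneg, (hw u (hreg u hu hlt)).1]
  have hstepX : ∀ u ∈ X, ∀ t ∈ Icc (0 : ℝ) 1, u - t • θ u • w u ∈ X := by
    intro u hu t ht
    rcases le_or_gt (I u) (s - b * r / 4) with hle | hlt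
    · simpa [hθz u hle] using hu
    have hI1 := hdrop u hu hlt t ht
    set v := u - t • θ u • w u with hv
    have hnorm : ‖u - v‖ = t * ‖θ u • w u‖ := by
      rw [hv, sub_sub_cancel, norm_smul, Real.norm_of_nonneg ht.1]
    have hnr : ‖u - v‖ ≤ r := by
      rw [hnorm, norm_smul, Real.norm_of_nonneg (hθ0 u)]
      have h1 := (hw u (hreg u hu hlt)).2.2.1
      have h2 : θ u * ‖w u‖ ≤ ‖w u‖ := mul_le_of_le_one_left (norm_nonneg _) (hθ1 u)
      have h3 : t * (θ u * ‖w u‖) ≤ θ u * ‖w u‖ :=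
        mul_le_of_le_one_left (mul_nonneg (hθ0 u) (norm_nonneg _)) ht.2
      linarith
    rw [← hnorm] at hI1
    have hN := norm_nonneg (u - v)
    have hF := norm_nonneg (fderiv ℝ I u)
    have hmono : I v ≤ I u := by nlinarith
    refine ⟨hmono.trans hu.1, ?_⟩
    have hu2 := hu.2
    have hlip := hDlip u v
    rcases le_or_gt (D u) (2 * r) with hD2 | hD2
    · have hb2 := hann u (hDX u hu hlt) hD2 (hu.1.trans hs)
      have h1 : ‖u - v‖ * (b / 2) ≤ ‖u - v‖ * (‖fderiv ℝ I u‖ / 2) := by gcongr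
      have h2 : min (D u) r ≤ min (D v) r + ‖u - v‖ := by
        rw [← min_add_add_right]
        exact min_le_min hlip (by linarith)
      nlinarith
    · have h1 : min (D v) r = r := min_eq_right (by linarith)
      have h2 : min (D u) r = r := min_eq_right (by linarith)
      rw [h2] at hu2
      rw [h1]
      linarith
  have hstepne : ∀ u ∈ X, s - b * r / 8 ≤ I u → θ u • w u ≠ 0 := by
    intro u hu hau
    have hlt : s - b * r / 4 < I u := by linarith
    refine smul_ne_zero (ne_of_gt ?_) (hw u (hreg u hu hlt)).2.1
    exact lt_max_of_lt_right (lt_min one_pos (by linarith))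
  obtain ⟨g, hgc, hgodd, hgmaps⟩ := exists_odd_deformation hIc hB hX hXsymm hstepc hstepodd
    hstepX (half_pos hβ) hdrop' hstepne
  have hXodd : HasOddMap X n :=
    h.comp hgc hgodd fun u hu => (show I (g u) < _ from hgmaps hu).le
  refine hXodd.add hX hXsymm p.continuous (map_neg p) fun u hu => ?_
  rcases le_or_gt (D u) r with hle | hlt
  · exact Or.inr (hp u (hle.trans (by linarith)))
  · refine Or.inl ⟨hu, ?_⟩
    rw [min_eq_right hlt.le]
    have : I u ≤ s := hu
    linarith

/-- The Palais–Smale condition at all levels below `cstar`. -/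
def PalaisSmaleBelow (I : E → ℝ) (cstar : ℝ) : Prop :=
  ∀ (u : ℕ → E) (c : ℝ), c < cstar →
    Tendsto (fun k => I (u k)) atTop (𝓝 c) →
    Tendsto (fun k => ‖fderiv ℝ I (u k)‖) atTop (𝓝 0) →
    ∃ (v : E) (φ : ℕ → ℕ), StrictMono φ ∧ Tendsto (u ∘ φ) atTop (𝓝 v)

theorem PalaisSmaleBelow.exists_subseq {I : E → ℝ} {cstar : ℝ} (h : PalaisSmaleBelow I cstar)
    {B t : ℝ} (hB : ∀ u, B ≤ I u) (ht : t < cstar) {u : ℕ → E} (hu : ∀ k, I (u k) ≤ t)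
    (hd : Tendsto (fun k => ‖fderiv ℝ I (u k)‖) atTop (𝓝 0)) :
    ∃ (v : E) (φ : ℕ → ℕ), StrictMono φ ∧ Tendsto (u ∘ φ) atTop (𝓝 v) := by
  obtain ⟨c, hc, φ, hφ, hlim⟩ := (isCompact_Icc (a := B) (b := t)).tendsto_subseq
    (x := fun k => I (u k)) fun k => ⟨hB _, hu k⟩
  obtain ⟨v, ψ, hψ, hv⟩ := h (u ∘ φ) c (hc.2.trans_lt ht) hlim (hd.comp hφ.tendsto_atTop)
  exact ⟨v, φ ∘ ψ, hφ.comp hψ, hv⟩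

theorem PalaisSmaleBelow.exists_slope_bound {I : E → ℝ} {cstar : ℝ}
    (h : PalaisSmaleBelow I cstar) (hI : ContDiff ℝ 1 I) {B t : ℝ} (hB : ∀ u, B ≤ I u)
    (ht : t < cstar) {Z : Set E} (hZ : IsClosed Z) (hZt : ∀ u ∈ Z, I u ≤ t)
    (hcrit : ∀ u ∈ Z, fderiv ℝ I u ≠ 0) :
    ∃ β : ℝ, 0 < β ∧ ∀ u ∈ Z, β ≤ ‖fderiv ℝ I u‖ := by
  by_contra! hcon
  choose u huZ hu using fun k : ℕ => hcon (1 / ((k : ℝ) + 1)) Nat.one_div_pos_of_nat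
  have hd : Tendsto (fun k => ‖fderiv ℝ I (u k)‖) atTop (𝓝 0) :=
    squeeze_zero (fun _ => norm_nonneg _) (fun k => (hu k).le)
      tendsto_one_div_add_atTop_nhds_zero_nat
  obtain ⟨v, φ, hφ, hv⟩ := h.exists_subseq hB ht (fun k => hZt _ (huZ k)) hd
  refine hcrit v (hZ.mem_of_tendsto hv (Eventually.of_forall fun k => huZ _)) ?_
  have h1 := (((hI.continuous_fderiv (by norm_num)).tendsto v).comp hv).norm
  exact norm_eq_zero.1 (tendsto_nhds_unique h1 (hd.comp hφ.tendsto_atTop))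

theorem PalaisSmaleBelow.isCompact_criticalSet {I : E → ℝ} {cstar : ℝ}
    (h : PalaisSmaleBelow I cstar) (hI : ContDiff ℝ 1 I) {B t : ℝ} (hB : ∀ u, B ≤ I u)
    (ht : t < cstar) (ρ : ℝ) :
    IsCompact {u : E | fderiv ℝ I u = 0 ∧ ρ ≤ ‖u‖ ∧ I u ≤ t} := by
  have hclosed : IsClosed {u : E | fderiv ℝ I u = 0 ∧ ρ ≤ ‖u‖ ∧ I u ≤ t} :=
    (isClosed_eq (hI.continuous_fderiv (by norm_num)) continuous_const).inter
      ((isClosed_le continuous_const continuous_norm).inter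
        (isClosed_le hI.continuous continuous_const))
  refine IsSeqCompact.isCompact fun u hu => ?_
  obtain ⟨v, φ, hφ, hv⟩ := h.exists_subseq hB ht (fun k => (hu k).2.2)
    (tendsto_const_nhds.congr fun k => by simp [(hu k).1])
  exact ⟨v, hclosed.mem_of_tendsto hv (Eventually.of_forall fun k => hu _), φ, hφ, hv⟩

/-- If the nonzero critical points at nonpositive levels stay away from the origin, then the
negative sublevel sets of `I` have uniformly bounded genus. -/
theorem exists_hasOddMap_sublevel [CompleteSpace E] [Nontrivial E] {I : E → ℝ}
    (hI : ContDiff ℝ 1 I) (heven : ∀ u, I (-u) = I u) {B : ℝ} (hB : ∀ u, B ≤ I u)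
    (hI0 : I 0 = 0) {cstar : ℝ} (hc : 0 < cstar) (hPS : PalaisSmaleBelow I cstar) {ρ : ℝ}
    (hρ : 0 < ρ) (hiso : ∀ u, fderiv ℝ I u = 0 → u ≠ 0 → I u ≤ 0 → ρ ≤ ‖u‖) :
    ∃ M : ℕ, ∀ s < 0, HasOddMap {u | I u ≤ s} M := by
  have hIc : Continuous I := hI.continuous
  obtain ⟨e, he⟩ := exists_ne (0 : E)
  set K : Set E := {u | fderiv ℝ I u = 0 ∧ ρ ≤ ‖u‖ ∧ I u ≤ 0} ∪ {e, -e} with hKdef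
  have hK : IsCompact K :=
    (hPS.isCompact_criticalSet hI hB hc ρ).union ((finite_singleton (-e)).insert e).isCompact
  have hKne : K.Nonempty := ⟨e, by simp [hKdef]⟩
  have hK0 : (0 : E) ∉ K := by
    rintro (h | h | h)
    · linarith [h.2.1, norm_zero (E := E)]
    · exact he h.symm
    · exact he (neg_eq_zero.1 (Eq.symm h))
  have hneg := fderiv_neg_of_even (hI.differentiable (by norm_num)) heven
  have hKsymm : ∀ u ∈ K, -u ∈ K := by
    rintro u (h | h | h)
    · exact Or.inl ⟨by rw [hneg, h.1, neg_zero], by simpa using h.2.1, by simpa [heven] using h.2.2⟩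
    · exact Or.inr (Or.inr (by simp [h]))
    · exact Or.inr (Or.inl (by rw [mem_singleton_iff.1 h, neg_neg]))
  obtain ⟨r, m, p, hr, hp⟩ := exists_clm_ne_zero_near_compact hK hKne hK0
  have hDc : Continuous fun u => Metric.infDist u K := Metric.continuous_infDist_pt K
  have hcritK : ∀ u, fderiv ℝ I u = 0 → u ≠ 0 → I u ≤ 0 → Metric.infDist u K = 0 :=
    fun u h1 h2 h3 => Metric.infDist_zero_of_mem (Or.inl ⟨h1, hiso u h1 h2 h3, h3⟩)
  obtain ⟨b, hb, hann⟩ := hPS.exists_slope_bound hI hB hc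
    (Z := {u | r / 2 ≤ Metric.infDist u K ∧ Metric.infDist u K ≤ 2 * r ∧ I u ≤ 0})
    ((isClosed_le continuous_const hDc).inter
      ((isClosed_le hDc continuous_const).inter (isClosed_le hIc continuous_const)))
    (fun u hu => hu.2.2) (fun u hu h0 => by
      have := hcritK u h0 (fun h => hp u hu.2.1 (by rw [h, map_zero])) hu.2.2
      linarith [hu.1])
  have hbr : 0 < b * r / 8 := by positivity
  have hlevel : ∀ k : ℕ, ∀ s < 0, s < B + k * (b * r / 8) → HasOddMap {u | I u ≤ s} (k * m) := by
    intro k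
    induction k with
    | zero =>
      intro s _ hsB
      have : {u | I u ≤ s} = ∅ := by
        refine eq_empty_of_forall_notMem fun u hu => ?_
        have h1 : I u ≤ s := hu
        have h2 := hB u
        simp at hsB
        linarith
      rw [this]
      exact ⟨fun _ => 0, continuousOn_empty _, by simp, by simp⟩
    | succ k ih =>
      intro s hs hsB
      push_cast at hsB
      obtain ⟨β, hβ, hfar⟩ := hPS.exists_slope_bound hI hB (hs.trans hc)
        (Z := {u | r / 2 ≤ Metric.infDist u K ∧ I u ≤ s})
        ((isClosed_le continuous_const hDc).inter (isClosed_le hIc continuous_const))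
        (fun u hu => hu.2) (fun u hu h0 => by
          have hus := hu.2
          have := hcritK u h0 (fun h => by rw [h, hI0] at hus; linarith) (hus.trans hs.le)
          linarith [hu.1])
      rw [Nat.succ_mul]
      exact HasOddMap.sublevel_step hI heven hB hKsymm hr hb hβ hs.le
        (fun u h1 h2 h3 => hann u ⟨h1, h2, h3⟩) (fun u h1 h2 => hfar u ⟨h1, h2⟩) hp
        (ih _ (by linarith) (by linarith))
  obtain ⟨k, hk⟩ := exists_nat_gt (-B / (b * r / 8))
  rw [div_lt_iff₀ hbr] at hk
  exact ⟨k * m, fun s hs => hlevel k s hs (by linarith)⟩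

end Auxiliary

/-- Kajikiya's symmetric mountain pass lemma with a local Palais–Smale condition:
if `I : E → ℝ` is `C¹`, even, bounded from below with `I(0) = 0` on an
infinite-dimensional Banach space, satisfies the Palais–Smale condition at every
level `c < c*` for some `c* > 0`, and for each `k` there is a closed symmetric set
`A_k ⊂ E∖{0}` of genus at least `k` on which `sup I < 0`, then there is a sequence
of nonzero critical points `u_k` with `I(u_k) ≤ 0` converging to `0`. -/
theorem symmetric_mountain_pass_local_PS
    {E : Type*} [NormedAddCommGroup E] [NormedSpace ℝ E] [CompleteSpace E]
    (hdim : ¬ FiniteDimensional ℝ E)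
    (I : E → ℝ) (hI : ContDiff ℝ 1 I)
    (heven : ∀ u : E, I (-u) = I u)
    (hbdd : BddBelow (Set.range I)) (hI0 : I 0 = 0)
    (hPS : ∃ cstar : ℝ, 0 < cstar ∧ ∀ (u : ℕ → E) (c : ℝ), c < cstar →
      Tendsto (fun k => I (u k)) atTop (nhds c) →
      Tendsto (fun k => ‖fderiv ℝ I (u k)‖) atTop (nhds 0) →
      ∃ (v : E) (φ : ℕ → ℕ), StrictMono φ ∧ Tendsto (u ∘ φ) atTop (nhds v))
    (hA : ∀ k : ℕ, ∃ A : Set E, IsClosed A ∧ (0 : E) ∉ A ∧ (∀ u ∈ A, -u ∈ A) ∧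
      (k : ℕ∞) ≤ genus A ∧ ∃ ε : ℝ, 0 < ε ∧ ∀ u ∈ A, I u ≤ -ε) :
    ∃ u : ℕ → E, (∀ k, fderiv ℝ I (u k) = 0) ∧ (∀ k, u k ≠ 0) ∧
      (∀ k, I (u k) ≤ 0) ∧ Tendsto u atTop (nhds 0) := by
  have : Nontrivial E := by
    by_contra hcon
    rw [not_nontrivial_iff_subsingleton] at hcon
    exact hdim inferInstance
  obtain ⟨B, hB⟩ := hbdd
  obtain ⟨cstar, hc, hPS⟩ := hPS
  have hclose : ∀ k : ℕ, ∃ u : E, fderiv ℝ I u = 0 ∧ u ≠ 0 ∧ I u ≤ 0 ∧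
      ‖u‖ < 1 / ((k : ℝ) + 1) := by
    intro k
    by_contra! hcon
    obtain ⟨M, hM⟩ := exists_hasOddMap_sublevel hI heven (fun u => hB ⟨u, rfl⟩) hI0 hc hPS
      (ρ := 1 / ((k : ℝ) + 1)) Nat.one_div_pos_of_nat hcon
    obtain ⟨A, -, -, -, hgenus, ε, hε, hAε⟩ := hA (M + 1)
    have hle := hgenus.trans ((hM (-ε) (by linarith)).mono hAε).genus_le
    have : M + 1 ≤ M := by exact_mod_cast hle
    omega
  choose u hu using hclose
  exact ⟨u, fun k => (hu k).1, fun k => (hu k).2.1, fun k => (hu k).2.2.1,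
    squeeze_zero_norm (fun k => (hu k).2.2.2.le) tendsto_one_div_add_atTop_nhds_zero_nat⟩
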